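/- arXiv:1603.06781 — 3 statements merged into one kernel-verified Lean document; each statement's English description precedes it below -/
import Mathlib

section
/- Let I be an admissible ideal on ℕ, let λ = (λ_i) and μ = (μ_i) be elements of Λ with λ_i ≤ μ_i for all i ∈ ℕ, and let α, β be fixed reals with 0 < α ≤ β ≤ 1. Let M = (M_j) be a Musielak–Orlicz function and ρ^(j) > 0 given scalars. If liminf_{i→∞} λ_i^α / μ_i^β > 0, then every real sequence x = (x_j) that is I_μ-statistically convergent of order β to Z with respect to M (i.e. x ∈ S^β_{I_μ}(M)) is also I_λ-statistically convergent of order α to Z with respect to M (i.e. x ∈ S^α_{I_λ}(M)); that is, S^β_{I_μ}(M) ⊆ S^α_{I_λ}(M). -/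
open Filter Finset

/-- An admissible ideal on ℕ: contains all finite sets, closed under subsets and
finite unions, and does not contain ℕ itself. -/
def AdmissibleIdeal (I : Set (Set ℕ)) : Prop :=
  (∀ A : Set ℕ, A.Finite → A ∈ I) ∧
  (∀ A B : Set ℕ, A ∈ I → B ⊆ A → B ∈ I) ∧
  (∀ A B : Set ℕ, A ∈ I → B ∈ I → A ∪ B ∈ I) ∧
  (Set.univ : Set ℕ) ∉ I

/-- Membership in Λ: a nondecreasing sequence of positive integers with `l i ≤ i`. -/
def InLambda (l : ℕ → ℕ) : Prop :=
  Monotone l ∧ (∀ i, 0 < l i) ∧ ∀ i, 1 ≤ i → l i ≤ i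

/-- The generalized de la Vallée-Poussin window `I_i = [i − λ_i + 1, i] ∩ ℕ`. -/
def window (l : ℕ → ℕ) (i : ℕ) : Finset ℕ := Finset.Icc (i - l i + 1) i

/-- A Musielak–Orlicz function: a sequence of continuous, nondecreasing, convex
functions on `[0,∞)` vanishing only at `0`. -/
def MusielakOrlicz (M : ℕ → ℝ → ℝ) : Prop :=
  ∀ j, ContinuousOn (M j) (Set.Ici 0) ∧ MonotoneOn (M j) (Set.Ici 0) ∧
    ConvexOn ℝ (Set.Ici 0) (M j) ∧ M j 0 = 0 ∧ ∀ t : ℝ, 0 < t → 0 < M j t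

open Classical in
/-- `x ∈ S^α_{I_λ}(M)` : `I_λ`-statistical convergence of order `α` to `Z`
with respect to the Musielak–Orlicz function `M` and scalars `ρ`. -/
def IStatConvM (I : Set (Set ℕ)) (l : ℕ → ℕ) (α : ℝ) (M : ℕ → ℝ → ℝ)
    (ρ : ℕ → ℝ) (x : ℕ → ℝ) (Z : ℝ) : Prop :=
  ∀ ε > (0:ℝ), ∀ δ > (0:ℝ),
    {i : ℕ | δ ≤ ((l i : ℝ) ^ (-α)) *
      ((window l i).filter (fun j => ε ≤ M j (|x j - Z| / ρ j))).card} ∈ I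

theorem window_subset_window {l m : ℕ → ℕ} (h : ∀ i, l i ≤ m i) (i : ℕ) :
    window l i ⊆ window m i := by
  intro j hj
  have := h i
  simp only [window, Finset.mem_Icc] at hj ⊢
  omega

theorem stat_incl_of_liminf_pos
    (I : Set (Set ℕ)) (hI : AdmissibleIdeal I)
    (lam mu : ℕ → ℕ) (hlam : InLambda lam) (hmu : InLambda mu)
    (hle : ∀ i, lam i ≤ mu i)
    (α β : ℝ) (hα : 0 < α) (hαβ : α ≤ β) (hβ : β ≤ 1)
    (M : ℕ → ℝ → ℝ) (hM : MusielakOrlicz M)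
    (ρ : ℕ → ℝ) (hρ : ∀ j, 0 < ρ j)
    (hliminf : 0 < Filter.atTop.liminf (fun i => (lam i : ℝ) ^ α / (mu i : ℝ) ^ β))
    (x : ℕ → ℝ) (Z : ℝ)
    (hx : IStatConvM I mu β M ρ x Z) :
    IStatConvM I lam α M ρ x Z := by
  classical
  intro ε hε δ hδ
  obtain ⟨hfin, hsub, hunion, -⟩ := hI
  obtain ⟨c, hc0, hc⟩ := exists_between hliminf
  have hbdd : IsBoundedUnder (· ≥ ·) atTop
      (fun i => (lam i : ℝ) ^ α / (mu i : ℝ) ^ β) :=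
    isBoundedUnder_of ⟨0, fun i => by positivity⟩
  have hev := eventually_lt_of_lt_liminf hc hbdd
  obtain ⟨n, hn⟩ := eventually_atTop.1 hev
  refine hsub _ _ (hunion _ _ (hfin _ (Set.finite_Iio n)) (hx ε hε (δ * c) (by positivity))) ?_
  intro i hi
  rcases lt_or_ge i n with hin | hin
  · exact Or.inl hin
  right
  have hl : (0 : ℝ) < (lam i : ℝ) ^ α :=
    Real.rpow_pos_of_pos (Nat.cast_pos.2 (hlam.2.1 i)) _
  have hm : (0 : ℝ) < (mu i : ℝ) ^ β :=
    Real.rpow_pos_of_pos (Nat.cast_pos.2 (hmu.2.1 i)) _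
  have hci := (lt_div_iff₀ hm).1 (hn i hin)
  simp only [Set.mem_ofPred_eq] at hi ⊢
  rw [Real.rpow_neg (Nat.cast_nonneg _), inv_mul_eq_div, le_div_iff₀ hl] at hi
  rw [Real.rpow_neg (Nat.cast_nonneg _), inv_mul_eq_div, le_div_iff₀ hm, mul_assoc]
  refine (mul_le_mul_of_nonneg_left hci.le hδ.le).trans (hi.trans ?_)
  exact_mod_cast Finset.card_le_card
    (Finset.filter_subset_filter _ (window_subset_window hle i))
end

section
/- Let I be an admissible ideal on ℕ, let λ = (λ_i) and μ = (μ_i) be elements of Λ with λ_i ≤ μ_i for all i ∈ ℕ, and let α, β be fixed reals with 0 < α ≤ β ≤ 1. Let M = (M_j) be a Musielak–Orlicz function and ρ^(j) > 0 given scalars. If lim_{i→∞} μ_i / λ_i^β = 1, then every real sequence x = (x_j) that is I_λ-statistically convergent of order α to Z with respect to M is also I_μ-statistically convergent of order β to Z with respect to M; that is, S^α_{I_λ}(M) ⊆ S^β_{I_μ}(M). -/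
open Filter Finset

open Classical in
/-- Enlarging the window from `l i` to `m i` adds at most `m i - l i` indices satisfying `p`. -/
theorem card_filter_window_le {l m : ℕ → ℕ} {i : ℕ} (h : l i ≤ m i)
    (p : ℕ → Prop) :
    (((window m i).filter p).card : ℝ) ≤ ((window l i).filter p).card + ((m i : ℝ) - l i) := by
  have hsub : (window m i).filter p ⊆
      (window l i).filter p ∪ Finset.Icc (i - m i + 1) (i - l i) := by
    intro j hj
    simp only [window, Finset.mem_filter, Finset.mem_union, Finset.mem_Icc] at hj ⊢
    by_cases hji : j ≤ i - l i
    · exact Or.inr ⟨hj.1.1, hji⟩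
    · exact Or.inl ⟨⟨by omega, hj.1.2⟩, hj.2⟩
  have hcard := (Finset.card_le_card hsub).trans (Finset.card_union_le _ _)
  rw [Nat.card_Icc] at hcard
  have hnat : ((window m i).filter p).card + l i ≤ ((window l i).filter p).card + m i := by
    omega
  have hreal : (((window m i).filter p).card : ℝ) + l i ≤
      ((window l i).filter p).card + m i := by
    exact_mod_cast hnat
  linarith

/-- The normalised excess of `b` over `a` is controlled by `b / a ^ β - 1`. -/
theorem rpow_neg_mul_le {a b c d α β : ℝ} (ha : 1 ≤ a) (hab : a ≤ b) (hα : 0 ≤ α)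
    (hαβ : α ≤ β) (hβ : β ≤ 1) (hc : 0 ≤ c) (hd : d ≤ c + (b - a)) :
    b ^ (-β) * d ≤ a ^ (-α) * c + (b / a ^ β - 1) := by
  have ha0 : 0 < a := by linarith
  have hpos : 0 < a ^ β := Real.rpow_pos_of_pos ha0 β
  have hself : a ^ β ≤ a := by
    simpa using Real.rpow_le_rpow_of_exponent_le ha hβ
  have hanti : b ^ (-β) ≤ a ^ (-β) := Real.rpow_le_rpow_of_nonpos ha0 hab (by linarith)
  have hexp : a ^ (-β) ≤ a ^ (-α) := Real.rpow_le_rpow_of_exponent_le ha (by linarith)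
  have hone : 1 ≤ a ^ (-β) * a := by
    rw [Real.rpow_neg ha0.le, inv_mul_eq_div]
    exact (one_le_div hpos).2 hself
  calc b ^ (-β) * d ≤ b ^ (-β) * (c + (b - a)) :=
        mul_le_mul_of_nonneg_left hd (Real.rpow_nonneg (by linarith) _)
    _ ≤ a ^ (-β) * (c + (b - a)) := mul_le_mul_of_nonneg_right hanti (by linarith)
    _ = a ^ (-β) * c + (a ^ (-β) * b - a ^ (-β) * a) := by ring
    _ ≤ a ^ (-α) * c + (a ^ (-β) * b - 1) :=
        add_le_add (mul_le_mul_of_nonneg_right hexp hc) (by linarith)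
    _ = a ^ (-α) * c + (b / a ^ β - 1) := by
        rw [Real.rpow_neg ha0.le β, inv_mul_eq_div]

theorem stat_incl_of_tendsto_one
    (I : Set (Set ℕ)) (hI : AdmissibleIdeal I)
    (lam mu : ℕ → ℕ) (hlam : InLambda lam) (hmu : InLambda mu)
    (hle : ∀ i, lam i ≤ mu i)
    (α β : ℝ) (hα : 0 < α) (hαβ : α ≤ β) (hβ : β ≤ 1)
    (M : ℕ → ℝ → ℝ) (hM : MusielakOrlicz M)
    (ρ : ℕ → ℝ) (hρ : ∀ j, 0 < ρ j)
    (hlim : Filter.Tendsto (fun i => (mu i : ℝ) / (lam i : ℝ) ^ β) Filter.atTop (nhds 1))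
    (x : ℕ → ℝ) (Z : ℝ)
    (hx : IStatConvM I lam α M ρ x Z) :
    IStatConvM I mu β M ρ x Z := by
  obtain ⟨hfin, hsubset, hunion, -⟩ := hI
  intro ε hε δ hδ
  have hev : ∀ᶠ i in Filter.atTop, (mu i : ℝ) / (lam i : ℝ) ^ β < 1 + δ / 2 :=
    hlim.eventually_lt_const (by linarith)
  rw [← Nat.cofinite_eq_atTop, Filter.eventually_cofinite] at hev
  refine hsubset _ _ (hunion _ _ (hx ε hε (δ / 2) (half_pos hδ)) (hfin _ hev)) ?_
  intro i hi
  by_contra hnot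
  simp only [Set.mem_union, Set.mem_ofPred_eq, not_or, not_le, not_not] at hi hnot
  have hbound := rpow_neg_mul_le (a := lam i) (b := mu i) (by exact_mod_cast hlam.2.1 i)
    (by exact_mod_cast hle i) hα.le hαβ hβ (Nat.cast_nonneg _)
    (card_filter_window_le (hle i) (fun j => ε ≤ M j (|x j - Z| / ρ j)))
  linarith [hnot.1, hnot.2]
end

section
/- Let I be an admissible ideal on ℕ, let λ = (λ_i) and μ = (μ_i) be elements of Λ with λ_i ≤ μ_i for all i ∈ ℕ, and let α, β be fixed reals with 0 < α ≤ β ≤ 1. Let M = (M_j) be a Musielak–Orlicz function and ρ^(j) > 0 given scalars. If liminf_{i→∞} λ_i^α / μ_i^β > 0, then every real sequence x = (x_j) that is I_μ-summable of order β to Z with respect to M is also I_λ-summable of order α to Z with respect to M; that is, w^β_{I_μ}(M) ⊆ w^α_{I_λ}(M). -/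
open Filter Finset

/-- `x ∈ w^α_{I_λ}(M)` : `I_λ`-summability of order `α` to `Z`
with respect to the Musielak–Orlicz function `M` and scalars `ρ`. -/
def ISummM (I : Set (Set ℕ)) (l : ℕ → ℕ) (α : ℝ) (M : ℕ → ℝ → ℝ)
    (ρ : ℕ → ℝ) (x : ℕ → ℝ) (Z : ℝ) : Prop :=
  ∀ ε > (0:ℝ),
    {i : ℕ | ε ≤ ((l i : ℝ) ^ (-α)) *
      ∑ j ∈ window l i, M j (|x j - Z| / ρ j)} ∈ I

theorem summ_incl_of_liminf_pos
    (I : Set (Set ℕ)) (hI : AdmissibleIdeal I)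
    (lam mu : ℕ → ℕ) (hlam : InLambda lam) (hmu : InLambda mu)
    (hle : ∀ i, lam i ≤ mu i)
    (α β : ℝ) (hα : 0 < α) (hαβ : α ≤ β) (hβ : β ≤ 1)
    (M : ℕ → ℝ → ℝ) (hM : MusielakOrlicz M)
    (ρ : ℕ → ℝ) (hρ : ∀ j, 0 < ρ j)
    (hliminf : 0 < Filter.atTop.liminf (fun i => (lam i : ℝ) ^ α / (mu i : ℝ) ^ β))
    (x : ℕ → ℝ) (Z : ℝ)
    (hx : ISummM I mu β M ρ x Z) :
    ISummM I lam α M ρ x Z := by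
  obtain ⟨hfin, hsub, hunion, -⟩ := hI
  obtain ⟨c, hc, hc_lt⟩ := exists_between hliminf
  have hev : ∀ᶠ i in atTop, c < (lam i : ℝ) ^ α / (mu i : ℝ) ^ β :=
    eventually_lt_of_lt_liminf hc_lt (isBoundedUnder_of ⟨0, fun i => by positivity⟩)
  obtain ⟨N, hN⟩ := eventually_atTop.1 hev
  intro ε hε
  refine hsub _ _ (hunion _ _ (hx (c * ε) (by positivity)) (hfin _ (Set.finite_Iio N))) ?_
  intro i hi
  by_cases hiN : i < N
  · exact Or.inr hiN
  refine Or.inl ?_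
  have hlam_pos : (0 : ℝ) < lam i := by exact_mod_cast hlam.2.1 i
  have hmu_pos : (0 : ℝ) < mu i := by exact_mod_cast hmu.2.1 i
  have hpow : 0 < (lam i : ℝ) ^ α := Real.rpow_pos_of_pos hlam_pos α
  have hM_nonneg : ∀ j, 0 ≤ M j (|x j - Z| / ρ j) := fun j => by
    have hj : 0 ≤ |x j - Z| / ρ j := div_nonneg (abs_nonneg _) (hρ j).le
    have h := (hM j).2.1 (Set.mem_Ici.2 le_rfl) hj hj
    rwa [(hM j).2.2.2.1] at h
  have hsum : ∑ j ∈ window lam i, M j (|x j - Z| / ρ j) ≤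
      ∑ j ∈ window mu i, M j (|x j - Z| / ρ j) := by
    refine sum_le_sum_of_subset_of_nonneg (Finset.Icc_subset_Icc ?_ le_rfl)
      fun j _ _ => hM_nonneg j
    have := hle i
    omega
  have hi' : ε ≤ (lam i : ℝ) ^ (-α) * ∑ j ∈ window lam i, M j (|x j - Z| / ρ j) := hi
  rw [Real.rpow_neg hlam_pos.le, inv_mul_eq_div, le_div_iff₀ hpow] at hi'
  have hratio := hN i (not_lt.1 hiN)
  rw [lt_div_iff₀ (Real.rpow_pos_of_pos hmu_pos β)] at hratio
  change c * ε ≤ (mu i : ℝ) ^ (-β) * ∑ j ∈ window mu i, M j (|x j - Z| / ρ j)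
  rw [Real.rpow_neg hmu_pos.le, inv_mul_eq_div,
    le_div_iff₀ (Real.rpow_pos_of_pos hmu_pos β)]
  calc c * ε * (mu i : ℝ) ^ β = ε * (c * (mu i : ℝ) ^ β) := by ring
    _ ≤ ε * (lam i : ℝ) ^ α := by gcongr
    _ ≤ _ := hi'.trans hsum
end
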